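/- arXiv:2407.08220 — 3 statements merged into one kernel-verified Lean document; each statement's English description precedes it below -/
import Mathlib

section
/- The Riemann theta series converges absolutely: for every Z ∈ ℂ^g, the family N ↦ exp(2πi(Z·N + ½ τN·N)), indexed by the integer vectors N ∈ ℤ^g, is summable. In particular the Riemann theta function Θ(Z) is well-defined for every Z ∈ ℂ^g. -/
/-- A product of nonnegative summable families, one in each coordinate, is summable over
the tuples. -/
theorem summable_prod_pi_of_nonneg {α : Type*} {n : ℕ} (f : Fin n → α → ℝ)
    (hf0 : ∀ i a, 0 ≤ f i a) (hf : ∀ i, Summable (f i)) :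
    Summable (fun N : Fin n → α => ∏ i, f i (N i)) := by
  induction n with
  | zero => exact Summable.of_finite
  | succ n ih =>
    rw [← (Fin.consEquiv (fun _ : Fin (n + 1) => α)).summable_iff]
    have h := (hf 0).mul_of_nonneg
      (ih (fun i => f i.succ) (fun i a => hf0 _ a) fun i => hf _) (hf0 0)
      (fun N => Finset.prod_nonneg fun i _ => hf0 _ _)
    refine h.congr fun p => ?_
    simp [Fin.consEquiv, Fin.prod_univ_succ]

/-- A positive definite real quadratic form dominates a positive multiple of the sum of
squares. -/
theorem Matrix.PosDef.exists_pos_mul_sum_sq_le {ι : Type*} [Fintype ι]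
    {A : Matrix ι ι ℝ} (hA : A.PosDef) :
    ∃ c : ℝ, 0 < c ∧ ∀ x : ι → ℝ, c * ∑ i, x i ^ 2 ≤ ∑ i, ∑ j, A i j * x i * x j := by
  let q : EuclideanSpace ℝ ι → ℝ := fun x => ∑ i, ∑ j, A i j * x i * x j
  have hq_pos : ∀ x : EuclideanSpace ℝ ι, x ≠ 0 → 0 < q x := by
    intro x hx
    have h := hA.dotProduct_mulVec_pos (x := WithLp.ofLp x) (by simpa using hx)
    refine h.trans_eq ?_
    simp only [q, dotProduct, Matrix.mulVec, Finset.mul_sum, Pi.star_apply, star_trivial]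
    exact Finset.sum_congr rfl fun i _ => Finset.sum_congr rfl fun j _ => by ring
  have hq_smul : ∀ (r : ℝ) (x : EuclideanSpace ℝ ι), q (r • x) = r ^ 2 * q x := by
    intro r x
    simp only [q, Finset.mul_sum, PiLp.smul_apply, smul_eq_mul]
    exact Finset.sum_congr rfl fun i _ => Finset.sum_congr rfl fun j _ => by ring
  have hq_cont : Continuous q := by fun_prop
  obtain ⟨c, hc, hcq⟩ : ∃ c : ℝ, 0 < c ∧
      ∀ x ∈ Metric.sphere (0 : EuclideanSpace ℝ ι) 1, c ≤ q x := by
    rcases (Metric.sphere (0 : EuclideanSpace ℝ ι) 1).eq_empty_or_nonempty with h | h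
    · exact ⟨1, one_pos, by simp [h]⟩
    · obtain ⟨x, hx, hmin⟩ :=
        (isCompact_sphere (0 : EuclideanSpace ℝ ι) 1).exists_isMinOn h hq_cont.continuousOn
      exact ⟨q x, hq_pos x (ne_zero_of_mem_unit_sphere ⟨x, hx⟩), fun y hy => hmin hy⟩
  refine ⟨c, hc, fun x => ?_⟩
  let y : EuclideanSpace ℝ ι := WithLp.toLp 2 x
  have hy : ∑ i, x i ^ 2 = ‖y‖ ^ 2 := by simp [EuclideanSpace.norm_sq_eq, y]
  change c * ∑ i, x i ^ 2 ≤ q y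
  rw [hy]
  rcases eq_or_ne y 0 with h0 | h0
  · simp [h0, q]
  · have hn : ‖y‖ ≠ 0 := norm_ne_zero_iff.mpr h0
    have h := hcq (‖y‖⁻¹ • y) (by simp [norm_smul, hn])
    rw [hq_smul, inv_pow, inv_mul_eq_div, le_div_iff₀ (by positivity)] at h
    exact h


/-- **Absolute convergence of the Riemann theta series.**
Fix an integer `g ≥ 1` and a symmetric `g × g` complex matrix `τ` whose entrywise imaginary
part is positive definite.  Then for every `Z ∈ ℂ^g` the family
`N ↦ exp (2πi (Z·N + ½ τN·N))`, indexed by integer vectors `N ∈ ℤ^g`, is summable; in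
particular the Riemann theta function `Θ(Z)` is well-defined. -/
theorem riemannTheta_summable (g : ℕ) (hg : 1 ≤ g)
    (τ : Matrix (Fin g) (Fin g) ℂ) (hτ_symm : τ.IsSymm)
    (hτ_pos : (τ.map Complex.im).PosDef) (Z : Fin g → ℂ) :
    Summable (fun N : Fin g → ℤ =>
      Complex.exp (2 * Real.pi * Complex.I *
        ((∑ k, Z k * (N k : ℂ)) +
          (1 / 2 : ℂ) * ∑ j, ∑ k, τ j k * (N j : ℂ) * (N k : ℂ)))) := by
  obtain ⟨c, hc, hcq⟩ := hτ_pos.exists_pos_mul_sum_sq_le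
  have hsum : Summable (fun N : Fin g → ℤ =>
      ∏ k, ‖jacobiTheta₂_term (N k) (Z k) (c * Complex.I)‖) :=
    summable_prod_pi_of_nonneg (fun k n => ‖jacobiTheta₂_term n (Z k) (c * Complex.I)‖)
      (fun _ _ => norm_nonneg _)
      fun k => ((summable_jacobiTheta₂_term_iff _ _).mpr (by simpa using hc)).norm
  refine Summable.of_norm_bounded hsum fun N => ?_
  simp only [norm_jacobiTheta₂_term]
  rw [← Real.exp_sum, Complex.norm_exp, Real.exp_le_exp]
  have h := hcq fun k => (N k : ℝ)
  have him : (2 * Real.pi * Complex.I * ((∑ k, Z k * (N k : ℂ)) +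
      (1 / 2 : ℂ) * ∑ j, ∑ k, τ j k * (N j : ℂ) * (N k : ℂ))).re =
      -(2 * Real.pi) * ∑ k, (Z k).im * N k -
        Real.pi * ∑ j, ∑ k, (τ.map Complex.im) j k * N j * N k := by
    have h2 : (1 / 2 : ℂ) = ((1 / 2 : ℝ) : ℂ) := by norm_num
    rw [h2, show (2 * Real.pi * Complex.I : ℂ) = ((2 * Real.pi : ℝ) : ℂ) * Complex.I by
      push_cast; ring, mul_assoc, Complex.re_ofReal_mul, Complex.I_mul_re, Complex.add_im,
      Complex.im_ofReal_mul]
    simp only [Complex.im_sum, Matrix.map_apply, ← Complex.ofReal_intCast,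
      Complex.im_mul_ofReal]
    ring
  have hrhs : ∑ k, (-Real.pi * (N k : ℝ) ^ 2 * (c * Complex.I).im -
      2 * Real.pi * N k * (Z k).im) =
      -(2 * Real.pi) * ∑ k, (Z k).im * N k - Real.pi * (c * ∑ k, (N k : ℝ) ^ 2) := by
    simp only [Finset.mul_sum, ← Finset.sum_sub_distrib]
    refine Finset.sum_congr rfl fun k _ => ?_
    rw [Complex.im_ofReal_mul, Complex.I_im]
    ring
  rw [him, hrhs]
  gcongr
end

section
/- For all ζ, z ∈ ℂ ∖ {0}, the denominators (e^{−2rk}ζ − ζ)(e^{−2rk}z − z) are nonzero for every k ≥ 1, and the infinite product ∏_{k=1}^∞ ((e^{−2rk}ζ − z)(e^{−2rk}z − ζ)) / ((e^{−2rk}ζ − ζ)(e^{−2rk}z − z)) converges (the family of factors indexed by k ≥ 1 is multipliable); hence the Schottky–Klein prime function ω(ζ,z) of the annulus is well-defined. -/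
/-- The factor of the annular Schottky–Klein product differs from `1` by
`-q (ζ - z)² / (ζ z (1 - q)²)`. -/
lemma schottkyKlein_factor_eq_one_add {ζ z q : ℂ} (hζ : ζ ≠ 0) (hz : z ≠ 0) (hq : q ≠ 1) :
    ((q * ζ - z) * (q * z - ζ)) / ((q * ζ - ζ) * (q * z - z)) =
      1 + -((ζ - z) ^ 2 / (ζ * z)) * (q / (1 - q) ^ 2) := by
  have h1 : 1 - q ≠ 0 := sub_ne_zero.mpr hq.symm
  have h2 : (q * ζ - ζ) * (q * z - z) = ζ * z * (1 - q) ^ 2 := by ring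
  rw [h2]
  field_simp
  ring

lemma summable_geometric_succ_div_one_sub_sq {a : ℝ} (ha : 0 ≤ a) (ha1 : a < 1) :
    Summable fun k : ℕ => a ^ (k + 1) / (1 - a ^ (k + 1)) ^ 2 := by
  have hs : Summable fun k : ℕ => a ^ (k + 1) / (1 - a) ^ 2 :=
    ((summable_nat_add_iff 1).mpr (summable_geometric_of_lt_one ha ha1)).div_const _
  refine hs.of_nonneg_of_le (fun k => by positivity) fun k => ?_
  have hk : a ^ (k + 1) ≤ a := pow_le_of_le_one ha ha1.le k.succ_ne_zero
  have h1 : 0 < 1 - a := sub_pos.mpr ha1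
  gcongr

/-- **Convergence of the Schottky–Klein prime function product for the annulus.**
Fix `r > 0`.  For all `ζ, z ∈ ℂ ∖ {0}`, the denominators
`(e^{−2rk}ζ − ζ)(e^{−2rk}z − z)` are nonzero for every `k ≥ 1`, and the family of factors
`((e^{−2rk}ζ − z)(e^{−2rk}z − ζ)) / ((e^{−2rk}ζ − ζ)(e^{−2rk}z − z))`, indexed by `k ≥ 1`,
is multipliable; hence the Schottky–Klein prime function `ω(ζ, z)` of the annulus
`{w : e^{−r} < |w| < 1}` is well-defined. -/
theorem schottkyKleinPrime_multipliable (r : ℝ) (hr : 0 < r) (ζ z : ℂ)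
    (hζ : ζ ≠ 0) (hz : z ≠ 0) :
    (∀ k : ℕ,
      ((Real.exp (-2 * r * (k + 1)) : ℂ) * ζ - ζ) *
        ((Real.exp (-2 * r * (k + 1)) : ℂ) * z - z) ≠ 0) ∧
    Multipliable (fun k : ℕ =>
      (((Real.exp (-2 * r * (k + 1)) : ℂ) * ζ - z) *
          ((Real.exp (-2 * r * (k + 1)) : ℂ) * z - ζ)) /
        (((Real.exp (-2 * r * (k + 1)) : ℂ) * ζ - ζ) *
          ((Real.exp (-2 * r * (k + 1)) : ℂ) * z - z))) := by
  have ha1 : Real.exp (-2 * r) < 1 := Real.exp_lt_one_iff.mpr (by linarith)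
  have hpow (k : ℕ) : Real.exp (-2 * r * (k + 1)) = Real.exp (-2 * r) ^ (k + 1) := by
    rw [← Real.exp_nat_mul]
    congr 1
    push_cast
    ring
  have hne (k : ℕ) : (Real.exp (-2 * r * (k + 1)) : ℂ) ≠ 1 := by
    rw [hpow]
    exact_mod_cast (pow_lt_one₀ (Real.exp_pos _).le ha1 k.succ_ne_zero).ne
  refine ⟨fun k => ?_, ?_⟩
  · rw [← sub_one_mul, ← sub_one_mul]
    have h := sub_ne_zero.mpr (hne k)
    exact mul_ne_zero (mul_ne_zero h hζ) (mul_ne_zero h hz)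
  · simp_rw [fun k : ℕ => schottkyKlein_factor_eq_one_add hζ hz (hne k)]
    refine multipliable_one_add_of_summable ?_
    simp_rw [norm_mul]
    refine Summable.mul_left _ ?_
    refine (summable_geometric_succ_div_one_sub_sq (Real.exp_pos (-2 * r)).le ha1).congr fun k => ?_
    rw [hpow, ← Complex.ofReal_one, ← Complex.ofReal_sub, ← Complex.ofReal_pow,
      ← Complex.ofReal_div, Complex.norm_real, Real.norm_of_nonneg (by positivity)]
end

section
/- The Schottky–Klein prime function of the annulus satisfies the reflection rule: for all ζ, z ∈ ℂ ∖ {0}, conj( ω(1/conj(ζ), 1/conj(z)) ) = −(1/(ζ z)) · ω(ζ,z), where conj denotes complex conjugation. -/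
/-- The Schottky–Klein prime function of the annulus `{w : e^{−r} < |w| < 1}`, defined for
`ζ, z ∈ ℂ ∖ {0}` by the convergent infinite product
`ω(ζ,z) = (ζ − z) · ∏_{k=1}^∞ ((e^{−2rk}ζ − z)(e^{−2rk}z − ζ)) / ((e^{−2rk}ζ − ζ)(e^{−2rk}z − z))`. -/
noncomputable def skPrime (r : ℝ) (ζ z : ℂ) : ℂ :=
  (ζ - z) * ∏' k : ℕ,
    (((Real.exp (-2 * r * (k + 1)) : ℂ) * ζ - z) *
        ((Real.exp (-2 * r * (k + 1)) : ℂ) * z - ζ)) /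
      (((Real.exp (-2 * r * (k + 1)) : ℂ) * ζ - ζ) *
        ((Real.exp (-2 * r * (k + 1)) : ℂ) * z - z))

/-- Each factor of the product defining the prime function is invariant under inversion
of both arguments. -/
theorem skPrime_factor_inv (a ζ z : ℂ) (hζ : ζ ≠ 0) (hz : z ≠ 0) :
    ((a * (1 / ζ) - 1 / z) * (a * (1 / z) - 1 / ζ)) /
        ((a * (1 / ζ) - 1 / ζ) * (a * (1 / z) - 1 / z)) =
      ((a * ζ - z) * (a * z - ζ)) / ((a * ζ - ζ) * (a * z - z)) := by
  by_cases ha : a = 1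
  · simp [ha]
  · have ha' : a - 1 ≠ 0 := sub_ne_zero.mpr ha
    have h₁ : a * (1 / ζ) - 1 / ζ = (a - 1) / ζ := by ring
    have h₂ : a * (1 / z) - 1 / z = (a - 1) / z := by ring
    have h₃ : a * ζ - ζ = (a - 1) * ζ := by ring
    have h₄ : a * z - z = (a - 1) * z := by ring
    rw [h₁, h₂, h₃, h₄]
    field_simp

/-- The prime function commutes with complex conjugation. -/
theorem conj_skPrime (r : ℝ) (ζ z : ℂ) :
    (starRingEnd ℂ) (skPrime r ζ z) =
      skPrime r ((starRingEnd ℂ) ζ) ((starRingEnd ℂ) z) := by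
  have conj_tprod (f : ℕ → ℂ) : (starRingEnd ℂ) (∏' k, f k) = ∏' k, (starRingEnd ℂ) (f k) :=
    Function.LeftInverse.map_tprod f (g := starRingEnd ℂ) (g' := starRingEnd ℂ)
      Complex.continuous_conj Complex.continuous_conj Complex.conj_conj
  simp only [skPrime, map_mul, map_sub, map_div₀, conj_tprod, Complex.conj_ofReal]

/-- **Reflection rule for the Schottky–Klein prime function of the annulus:**
for all `ζ, z ∈ ℂ ∖ {0}`, `conj (ω(1/conj ζ, 1/conj z)) = −(1/(ζz)) · ω(ζ, z)`. -/
theorem skPrime_reflection (r : ℝ) (hr : 0 < r) (ζ z : ℂ) (hζ : ζ ≠ 0) (hz : z ≠ 0) :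
    (starRingEnd ℂ) (skPrime r (1 / (starRingEnd ℂ) ζ) (1 / (starRingEnd ℂ) z)) =
      -(1 / (ζ * z)) * skPrime r ζ z := by
  rw [conj_skPrime]
  simp only [map_div₀, map_one, Complex.conj_conj, skPrime, skPrime_factor_inv _ ζ z hζ hz]
  rw [← mul_assoc]
  congr 1
  field_simp
  ring
end
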